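/- arXiv:cs/0009001 — 2 statements merged into one kernel-verified Lean document; each statement's English description precedes it below -/
import Mathlib

section
/- Let U and W be partial functions from pairs (program, data) of finite binary strings to finite binary strings ("computers"), and for a computer C define the conditional Kolmogorov complexity K_C(α|d) as the minimum length of a program p with C(p,d) = α. Let B be an injective pairing map on pairs of finite binary strings, write ⟨x,y⟩ = B(x,y), and let Λ denote the empty string. Fix a data string d, a nonempty string γ, and a constant κ ∈ ℕ. Assume: (i) W(p, ⟨Λ, d⟩) = U(p, d) for all programs p; (ii) there is a bijection φ from the set {p : ∃ r, U(p,d) = ⟨r,γ⟩} onto the set {q : W(q, ⟨γ,d⟩) is defined} such that whenever U(p,d) = ⟨r,γ⟩ one has W(φ(p), ⟨γ,d⟩) = r and |φ(p)| = |p| − K_U(γ|d) + κ (in particular K_U(γ|d) is finite and |p| ≥ K_U(γ|d) − κ for all such p). Then for every string α such that some program p satisfies U(p,d) = ⟨α,γ⟩, one has K_W(α | ⟨γ,d⟩) = K_W(⟨α,γ⟩ | ⟨Λ,d⟩) − K_W(γ | ⟨Λ,d⟩) + κ. -/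
/-- Conditional Kolmogorov complexity of `α` given data `d` relative to the
computer `C`: the minimum length of a program `p` with `C p d = α`. -/
noncomputable def Kc (C : List Bool → List Bool → Option (List Bool)) (α d : List Bool) : ℕ :=
  sInf {n : ℕ | ∃ p : List Bool, C p d = some α ∧ p.length = n}

theorem exists_length_eq_Kc {C : List Bool → List Bool → Option (List Bool)} {α d : List Bool}
    (h : ∃ p, C p d = some α) : ∃ p, C p d = some α ∧ p.length = Kc C α d := by
  obtain ⟨p, hp⟩ := h
  exact Nat.sInf_mem (s := {n : ℕ | ∃ p : List Bool, C p d = some α ∧ p.length = n})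
    ⟨p.length, p, hp, rfl⟩

theorem Kc_le_length {C : List Bool → List Bool → Option (List Bool)} {α d p : List Bool}
    (h : C p d = some α) : Kc C α d ≤ p.length :=
  Nat.sInf_le ⟨p, h, rfl⟩

theorem Kc_congr {C C' : List Bool → List Bool → Option (List Bool)} {d d' : List Bool}
    (h : ∀ p, C p d = C' p d') (α : List Bool) : Kc C α d = Kc C' α d' := by
  simp only [Kc, h]

theorem stmt0
    (U W : List Bool → List Bool → Option (List Bool))
    (B : List Bool → List Bool → List Bool)
    (hB : Function.Injective2 B)
    (d γ : List Bool) (hγ : γ ≠ []) (κ : ℕ)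
    -- (i) W simulates U on data ⟨Λ, d⟩
    (hsim : ∀ p : List Bool, W p (B [] d) = U p d)
    -- K_U(γ|d) is finite
    (hfin : ∃ p : List Bool, U p d = some γ)
    -- (ii) the bijection φ
    (φ : List Bool → List Bool)
    (hbij : Set.BijOn φ {p : List Bool | ∃ r : List Bool, U p d = some (B r γ)}
                        {q : List Bool | (W q (B γ d)).isSome})
    (hφ : ∀ p r : List Bool, U p d = some (B r γ) →
      W (φ p) (B γ d) = some r ∧
      ((φ p).length : ℤ) = (p.length : ℤ) - (Kc U γ d : ℤ) + (κ : ℤ)) :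
    ∀ α : List Bool, (∃ p : List Bool, U p d = some (B α γ)) →
      (Kc W α (B γ d) : ℤ)
        = (Kc W (B α γ) (B [] d) : ℤ) - (Kc W γ (B [] d) : ℤ) + (κ : ℤ) := by
  intro α hα
  rw [Kc_congr hsim, Kc_congr hsim]
  obtain ⟨p, hp, hpl⟩ := exists_length_eq_Kc hα
  obtain ⟨hWp, hlen⟩ := hφ p α hp
  have hle := Kc_le_length hWp
  obtain ⟨q, hq, hql⟩ := exists_length_eq_Kc ⟨φ p, hWp⟩
  obtain ⟨p', ⟨r, hr⟩, rfl⟩ := hbij.surjOn (show q ∈ {q | (W q (B γ d)).isSome} by simp [hq])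
  obtain ⟨hWr, hlen'⟩ := hφ p' r hr
  obtain rfl : α = r := Option.some.inj (hq.symm.trans hWr)
  have hle' := Kc_le_length hr
  omega
end

section
/- Let l : ℕ → ℕ be a sequence of natural numbers such that the sum over k of 2^{−l(k)} is at most 1 (as a tsum in the extended nonnegative reals). Then there exists an injective function c : ℕ → (finite binary strings) such that |c(k)| = l(k) for every k and the range of c is prefix-free, i.e. no string c(j) is a prefix of a different string c(k). -/
open scoped ENNReal

/-- The `n` lowest binary digits of `m`, most significant digit first. -/
def binaryWord (n m : ℕ) : List Bool :=
  List.ofFn fun i : Fin n => m.testBit (n - 1 - i)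

theorem length_binaryWord (n m : ℕ) : (binaryWord n m).length = n := by
  simp [binaryWord]

theorem eq_div_two_pow_of_prefix_binaryWord {a b x y : ℕ} (hx : x < 2 ^ a) (hy : y < 2 ^ b)
    (h : binaryWord a x <+: binaryWord b y) : x = y / 2 ^ (b - a) := by
  have hab : a ≤ b := by simpa only [length_binaryWord] using h.length_le
  have hy' : y / 2 ^ (b - a) < 2 ^ a := by
    rw [Nat.div_lt_iff_lt_mul (by positivity), ← pow_add]
    rwa [Nat.add_sub_cancel' hab]
  apply Nat.eq_of_testBit_eq
  intro i
  by_cases hi : i < a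
  · have hlen : a - 1 - i < (binaryWord a x).length := by
      rw [length_binaryWord]
      omega
    have key := h.getElem hlen
    simp only [binaryWord, List.getElem_ofFn] at key
    rw [Nat.testBit_div_two_pow]
    convert key using 2 <;> omega
  · have hpow : 2 ^ a ≤ 2 ^ i := Nat.pow_le_pow_right two_pos (not_lt.mp hi)
    rw [Nat.testBit_lt_two_pow (hx.trans_le hpow), Nat.testBit_lt_two_pow (hy'.trans_le hpow)]

theorem sum_two_pow_sub_le_of_kraft {l : ℕ → ℕ}
    (hkraft : ∑' k : ℕ, ((2 : ℝ≥0∞) ^ (-(l k : ℤ))) ≤ 1) (s : Finset ℕ) (n : ℕ)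
    (hs : ∀ j ∈ s, l j ≤ n) : ∑ j ∈ s, 2 ^ (n - l j) ≤ 2 ^ n := by
  have key : ((∑ j ∈ s, 2 ^ (n - l j) : ℕ) : ℝ≥0∞) ≤ ((2 ^ n : ℕ) : ℝ≥0∞) := by
    push_cast
    calc ∑ j ∈ s, (2 : ℝ≥0∞) ^ (n - l j)
        = ∑ j ∈ s, (2 : ℝ≥0∞) ^ n * 2 ^ (-(l j : ℤ)) := by
          refine Finset.sum_congr rfl fun j hj => ?_
          rw [← zpow_natCast, ← zpow_natCast, ← ENNReal.zpow_add two_ne_zero ENNReal.ofNat_ne_top,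
            Nat.cast_sub (hs j hj), sub_eq_add_neg]
      _ = (2 : ℝ≥0∞) ^ n * ∑ j ∈ s, (2 : ℝ≥0∞) ^ (-(l j : ℤ)) := by rw [Finset.mul_sum]
      _ ≤ (2 : ℝ≥0∞) ^ n * 1 := by
          gcongr
          exact (ENNReal.sum_le_tsum s).trans hkraft
      _ = 2 ^ n := mul_one _
  exact_mod_cast key

theorem finite_setOf_le_of_kraft {l : ℕ → ℕ}
    (hkraft : ∑' k : ℕ, ((2 : ℝ≥0∞) ^ (-(l k : ℤ))) ≤ 1) (n : ℕ) : {j | l j ≤ n}.Finite := by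
  refine (ENNReal.finite_const_le_of_tsum_ne_top (ne_top_of_le_ne_top ENNReal.one_ne_top hkraft)
    (ε := (2 : ℝ≥0∞) ^ (-(n : ℤ))) (ENNReal.zpow_pos two_ne_zero ENNReal.ofNat_ne_top _).ne').subset
      fun j hj => ?_
  have hj' : l j ≤ n := hj
  exact ENNReal.zpow_le_of_le one_le_two (by omega)

theorem stmt6 (l : ℕ → ℕ)
    (hkraft : ∑' k : ℕ, ((2 : ℝ≥0∞) ^ (-(l k : ℤ))) ≤ 1) :
    ∃ c : ℕ → List Bool, Function.Injective c ∧
      (∀ k : ℕ, (c k).length = l k) ∧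
      (∀ j k : ℕ, c j ≠ c k → ¬ c j <+: c k) := by
  have hfin (k : ℕ) : {j | l j < l k ∨ l j = l k ∧ j < k}.Finite :=
    (finite_setOf_le_of_kraft hkraft (l k)).subset fun j hj => by
      simp only [Set.mem_ofPred_eq] at hj ⊢
      omega
  let pred (k : ℕ) : Finset ℕ := (hfin k).toFinset
  have mem_pred (j k : ℕ) : j ∈ pred k ↔ l j < l k ∨ l j = l k ∧ j < k := by simp [pred]
  have self_notMem (k : ℕ) : k ∉ pred k := by simp [mem_pred]
  let m (k : ℕ) : ℕ := ∑ j ∈ pred k, 2 ^ (l k - l j)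
  have m_lt (k : ℕ) : m k < 2 ^ l k := by
    have h := sum_two_pow_sub_le_of_kraft hkraft (insert k (pred k)) (l k) fun j hj => by
      rw [Finset.mem_insert, mem_pred] at hj
      rcases hj with rfl | hj <;> omega
    rw [Finset.sum_insert (self_notMem k), Nat.sub_self, pow_zero] at h
    change 1 + m k ≤ _ at h
    omega
  have m_step {j k : ℕ} (hjk : j ∈ pred k) : (m j + 1) * 2 ^ (l k - l j) ≤ m k := by
    have hjk' := (mem_pred j k).1 hjk
    calc (m j + 1) * 2 ^ (l k - l j)
        = ∑ i ∈ insert j (pred j), 2 ^ (l k - l i) := by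
          rw [Finset.sum_insert (self_notMem j), add_mul, one_mul, add_comm, Finset.sum_mul]
          congr 1
          refine Finset.sum_congr rfl fun i hi => ?_
          rw [mem_pred] at hi
          rw [← pow_add]
          congr 1
          omega
      _ ≤ m k := by
          refine Finset.sum_le_sum_of_subset fun i hi => ?_
          rw [Finset.mem_insert, mem_pred] at hi
          rw [mem_pred]
          rcases hi with rfl | hi <;> omega
  have index_eq {j k : ℕ} (h : binaryWord (l j) (m j) <+: binaryWord (l k) (m k)) :
      j = k := by
    have hle : l j ≤ l k := by simpa only [length_binaryWord] using h.length_le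
    have hm := eq_div_two_pow_of_prefix_binaryWord (m_lt j) (m_lt k) h
    by_contra hne
    by_cases hjk : j ∈ pred k
    · have := (Nat.le_div_iff_mul_le (by positivity)).2 (m_step hjk)
      omega
    · rw [mem_pred] at hjk
      have hl : l j = l k := by omega
      have hstep := m_step ((mem_pred k j).2 (by omega))
      simp only [hl, Nat.sub_self, pow_zero, mul_one, Nat.div_one] at hm hstep
      omega
  refine ⟨fun k => binaryWord (l k) (m k), fun j k h => ?_, fun k => length_binaryWord _ _,
    fun j k hne h => hne (by rw [index_eq h])⟩
  have heq : binaryWord (l j) (m j) = binaryWord (l k) (m k) := h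
  exact index_eq (heq ▸ List.prefix_rfl)
end
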